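/- Fix n ∈ ℕ, n ≥ 1, and ξ ∈ [0,1); let k* ∈ {1,…,2^n} be the index with ξ ∈ I_n(k*). Then the entries a^ξ_{ij} (i, j = 0,…,2^n−1) of the matrix W^{−1}(Ĵ^ξ)^⊤W are given as follows. If k* ≤ i: a^ξ_{ij} = 1/2^{n+1} if i = j; a^ξ_{ij} = 1/2^n if k* ≤ j < i; a^ξ_{ij} = k*/2^n − ξ if j = k*−1 < i; a^ξ_{ij} = 0 otherwise. If k* = i+1: a^ξ_{ij} = (2k*−1)/2^{n+1} − ξ if j = i = k*−1, and a^ξ_{ij} = 0 otherwise. If k* > i+1: a^ξ_{ij} = −1/2^{n+1} if i = j; a^ξ_{ij} = −1/2^n if i+1 ≤ j ≤ k*−2; a^ξ_{ij} = (k*−1)/2^n − ξ if i < j = k*−1; a^ξ_{ij} = 0 otherwise. -/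

import Mathlib

open MeasureTheory Matrix

/-- The `k`-th binary digit of `x ∈ [0,1)`, using the expansion terminating in zeros
for dyadic rationals. -/
noncomputable def binDigit (k : ℕ) (x : ℝ) : ℕ := ⌊x * 2 ^ (k + 1)⌋.toNat % 2

/-- Rademacher functions `r_k(x) = (-1)^{x_k}`. -/
noncomputable def rademacher (k : ℕ) (x : ℝ) : ℝ := (-1 : ℝ) ^ binDigit k x

/-- Walsh–Paley functions `ω_n(x) = ∏_k r_k(x)^{n_k}`. -/
noncomputable def walsh (n : ℕ) (x : ℝ) : ℝ :=
  ∏ k ∈ Finset.range n, if n.testBit k then rademacher k x else 1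

/-- Walsh–Fourier coefficient `f̂_k = ∫₀¹ f ω_k`. -/
noncomputable def fcoef (f : ℝ → ℝ) (k : ℕ) : ℝ := ∫ x in (0:ℝ)..1, f x * walsh k x

/-- The `2^n`-th partial sum of the Walsh–Fourier series:
`S_{2^n} f (x) = ∑_{k<2^n} f̂_k ω_k(x)`. -/
noncomputable def S2 (n : ℕ) (f : ℝ → ℝ) (x : ℝ) : ℝ :=
  ∑ k ∈ Finset.range (2 ^ n), fcoef f k * walsh k x

/-- The Hadamard matrix `W` of size `2^n × 2^n` with entries `W_{ij} = ω_j(i/2^n)`. -/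
noncomputable def Wmat (n : ℕ) : Matrix (Fin (2 ^ n)) (Fin (2 ^ n)) ℝ :=
  fun i j => walsh j.1 ((i.1 : ℝ) / 2 ^ n)

/-- The matrix `Ĵ^ξ` with entries `(Ĵ^ξ)_{k,j} = ∫₀¹ J_k^ξ(x) ω_j(x) dx`, where
`J_k^ξ(x) = ∫_ξ^x ω_k(t) dt`. -/
noncomputable def Jhat (n : ℕ) (ξ : ℝ) : Matrix (Fin (2 ^ n)) (Fin (2 ^ n)) ℝ :=
  fun k j => ∫ x in (0:ℝ)..1, (∫ t in ξ..x, walsh k.1 t) * walsh j.1 x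

/-- The dyadic circulant matrix `P` with entries `P_{ij} = p̂_{i ⊕ j}`. -/
noncomputable def Pmat (n : ℕ) (p : ℝ → ℝ) : Matrix (Fin (2 ^ n)) (Fin (2 ^ n)) ℝ :=
  fun i j => fcoef p (i.1 ^^^ j.1)

open Set in
theorem integral_indicator_Ico_one {a b : ℝ} (hab : a ≤ b) (ξ x : ℝ) :
    ∫ t in ξ..x, (Ico a b).indicator (fun _ => (1 : ℝ)) t =
      max a (min x b) - max a (min ξ b) := by
  wlog h : ξ ≤ x generalizing ξ x
  · rw [intervalIntegral.integral_symm, this x ξ (le_of_not_ge h)]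
    ring
  have hset : (Ioc ξ x ∩ Ico a b : Set ℝ) =ᵐ[volume] (Ioc ξ x ∩ Ioc a b : Set ℝ) :=
    ae_eq_set_inter ae_eq_rfl Ico_ae_eq_Ioc
  rw [intervalIntegral.integral_of_le h, setIntegral_indicator measurableSet_Ico,
    setIntegral_congr_set hset, Ioc_inter_Ioc, setIntegral_const, Real.volume_real_Ioc]
  simp only [smul_eq_mul, mul_one]
  grind

theorem measurable_walsh (n : ℕ) : Measurable (walsh n) := by
  unfold walsh
  refine Finset.measurable_prod _ fun k _ => ?_
  split_ifs
  · have h : Measurable fun x : ℝ => ⌊x * 2 ^ (k + 1)⌋ :=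
      Int.measurable_floor.comp (measurable_id.mul_const _)
    exact (measurable_of_countable fun z : ℤ => (-1 : ℝ) ^ (z.toNat % 2)).comp h
  · exact measurable_const

theorem abs_walsh (n : ℕ) (x : ℝ) : |walsh n x| = 1 := by
  unfold walsh
  rw [Finset.abs_prod]
  refine Finset.prod_eq_one fun k _ => ?_
  split_ifs
  · simp [rademacher, abs_pow]
  · simp

theorem intervalIntegrable_walsh (n : ℕ) (a b : ℝ) :
    IntervalIntegrable (walsh n) volume a b := by
  rw [intervalIntegrable_iff]
  exact Measure.integrableOn_of_bounded (M := 1) measure_Ioc_lt_top.ne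
    (measurable_walsh n).aestronglyMeasurable (ae_of_all _ fun x => (abs_walsh n x).le)

/-- The common value of `walsh j` on the dyadic interval `[i / 2 ^ n, (i + 1) / 2 ^ n)`. -/
def walshSign (n j i : ℕ) : ℝ :=
  ∏ k ∈ Finset.range n, if j.testBit k then (if i.testBit (n - 1 - k) then -1 else 1) else 1

theorem walshSign_comm (n i j : ℕ) : walshSign n i j = walshSign n j i := by
  unfold walshSign
  rw [← Finset.prod_range_reflect]
  refine Finset.prod_congr rfl fun k hk => ?_
  have hk : n - 1 - (n - 1 - k) = k := by
    have := Finset.mem_range.1 hk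
    omega
  rw [hk]
  split_ifs <;> rfl

theorem rademacher_eq_of_floor {n k : ℕ} (hk : k < n) (x : ℝ) :
    rademacher k x = if (⌊x * 2 ^ n⌋₊).testBit (n - 1 - k) then -1 else 1 := by
  have hfl : ⌊x * 2 ^ (k + 1)⌋.toNat = ⌊x * 2 ^ n⌋₊ / 2 ^ (n - 1 - k) := by
    have hpow : (2 : ℝ) ^ n = 2 ^ (k + 1) * 2 ^ (n - 1 - k) := by
      rw [← pow_add]
      congr 1
      omega
    rw [Int.floor_toNat, ← Nat.floor_div_natCast, hpow]
    congr 1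
    push_cast
    field_simp
  rw [rademacher, binDigit, hfl, Nat.testBit_eq_decide_div_mod_eq]
  rcases Nat.mod_two_eq_zero_or_one (⌊x * 2 ^ n⌋₊ / 2 ^ (n - 1 - k)) with h | h <;> simp [h]

theorem walsh_eq_walshSign {n j : ℕ} (hj : j < 2 ^ n) (x : ℝ) :
    walsh j x = walshSign n j ⌊x * 2 ^ n⌋₊ := by
  have hext : ∀ N M : ℕ, N ≤ M → j < 2 ^ N →
      ∏ k ∈ Finset.range N, (if j.testBit k then rademacher k x else 1) =
        ∏ k ∈ Finset.range M, (if j.testBit k then rademacher k x else 1) := by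
    intro N M hNM hjN
    refine Finset.prod_subset (Finset.range_mono hNM) fun k _ hk => ?_
    have hk : N ≤ k := by simpa using hk
    simp [Nat.testBit_lt_two_pow (hjN.trans_le (Nat.pow_le_pow_right two_pos hk))]
  rw [walsh, hext j (max j n) (le_max_left _ _) Nat.lt_two_pow_self,
    ← hext n (max j n) (le_max_right _ _) hj, walshSign]
  refine Finset.prod_congr rfl fun k hk => ?_
  rw [rademacher_eq_of_floor (Finset.mem_range.1 hk)]

theorem sum_prod_testBit (f : ℕ → ℝ) (n : ℕ) :
    ∑ j ∈ Finset.range (2 ^ n), ∏ k ∈ Finset.range n, (if j.testBit k then f k else 1) =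
      ∏ k ∈ Finset.range n, (1 + f k) := by
  induction n with
  | zero => simp
  | succ n ih =>
    rw [pow_succ, mul_two, Finset.sum_range_add, Finset.prod_range_succ, ← ih, mul_add, mul_one,
      Finset.sum_mul]
    congr 1
    · refine Finset.sum_congr rfl fun j hj => ?_
      rw [Finset.prod_range_succ, Nat.testBit_lt_two_pow (Finset.mem_range.1 hj)]
      simp
    · refine Finset.sum_congr rfl fun j hj => ?_
      rw [Finset.prod_range_succ, Nat.testBit_two_pow_add_eq,
        Nat.testBit_lt_two_pow (Finset.mem_range.1 hj)]
      simp only [Bool.not_false, if_true]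
      congr 1
      refine Finset.prod_congr rfl fun k hk => ?_
      rw [Nat.testBit_two_pow_add_gt (Finset.mem_range.1 hk)]

theorem sum_walshSign_mul_walshSign {n i i' : ℕ} (hi : i < 2 ^ n) (hi' : i' < 2 ^ n) :
    ∑ j ∈ Finset.range (2 ^ n), walshSign n j i * walshSign n j i' =
      if i = i' then 2 ^ n else 0 := by
  let f (k : ℕ) : ℝ := (if i.testBit (n - 1 - k) then -1 else 1) *
    (if i'.testBit (n - 1 - k) then -1 else 1)
  have hmul : ∀ j, walshSign n j i * walshSign n j i' =
      ∏ k ∈ Finset.range n, (if j.testBit k then f k else 1) := by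
    intro j
    rw [walshSign, walshSign, ← Finset.prod_mul_distrib]
    refine Finset.prod_congr rfl fun k _ => ?_
    by_cases h : j.testBit k <;> simp [h, f]
  simp_rw [hmul]
  rw [sum_prod_testBit]
  split_ifs with h
  · subst h
    have hf : ∀ k, 1 + f k = 2 := fun k => by
      by_cases hb : i.testBit (n - 1 - k) <;> norm_num [f, hb]
    simp [hf]
  · obtain ⟨b, hb⟩ : ∃ b, i.testBit b ≠ i'.testBit b := by
      by_contra! hall
      exact h (Nat.eq_of_testBit_eq hall)
    have hbn : b < n := by
      by_contra! hnb
      have hpow := Nat.pow_le_pow_right two_pos hnb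
      exact hb (by rw [Nat.testBit_lt_two_pow (hi.trans_le hpow),
        Nat.testBit_lt_two_pow (hi'.trans_le hpow)])
    refine Finset.prod_eq_zero (Finset.mem_range.2 (show n - 1 - b < n by omega)) ?_
    have hbb : n - 1 - (n - 1 - b) = b := by omega
    simp only [f, hbb]
    rcases h1 : i.testBit b <;> rcases h2 : i'.testBit b <;> simp_all

theorem Wmat_apply (n : ℕ) (i j : Fin (2 ^ n)) : Wmat n i j = walshSign n j i := by
  rw [Wmat, walsh_eq_walshSign j.2, div_mul_cancel₀ _ (by positivity),
    Nat.floor_natCast]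

theorem Wmat_comm (n : ℕ) (i j : Fin (2 ^ n)) : Wmat n i j = Wmat n j i := by
  rw [Wmat_apply, Wmat_apply, walshSign_comm]

theorem inv_Wmat (n : ℕ) : (Wmat n)⁻¹ = ((2 : ℝ) ^ n)⁻¹ • Wmat n := by
  refine Matrix.inv_eq_left_inv ?_
  ext i j
  rw [Matrix.smul_mul, Matrix.smul_apply, Matrix.mul_apply]
  have h : ∀ k, Wmat n i k * Wmat n k j = walshSign n k i * walshSign n k j := fun k => by
    rw [Wmat_comm n k j, Wmat_apply, Wmat_apply]
  simp_rw [h]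
  rw [Fin.sum_univ_eq_sum_range (fun k => walshSign n k i * walshSign n k j),
    sum_walshSign_mul_walshSign i.2 j.2, Matrix.one_apply]
  simp only [← Fin.ext_iff]
  split_ifs <;> simp

theorem sum_Wmat_mul_walsh (n : ℕ) (i : Fin (2 ^ n)) {x : ℝ} (hx : x ∈ Set.Ico (0 : ℝ) 1) :
    ∑ j, Wmat n i j * walsh j x = 2 ^ n *
      (Set.Ico ((i : ℝ) / 2 ^ n) (((i : ℝ) + 1) / 2 ^ n)).indicator (fun _ => (1 : ℝ)) x := by
  have hpos : (0 : ℝ) < 2 ^ n := by positivity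
  have hnn : 0 ≤ x * 2 ^ n := mul_nonneg hx.1 hpos.le
  have hfl : ⌊x * 2 ^ n⌋₊ < 2 ^ n := by
    rw [Nat.floor_lt hnn]
    push_cast
    nlinarith [hx.2]
  have h : ∀ j : Fin (2 ^ n), Wmat n i j * walsh j x =
      walshSign n j i * walshSign n j ⌊x * 2 ^ n⌋₊ := fun j => by
    rw [Wmat_apply, walsh_eq_walshSign j.2]
  simp_rw [h]
  rw [Fin.sum_univ_eq_sum_range (fun k => walshSign n k i * walshSign n k ⌊x * 2 ^ n⌋₊),
    sum_walshSign_mul_walshSign i.2 hfl, Set.indicator_apply]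
  simp only [Set.mem_Ico, div_le_iff₀ hpos, lt_div_iff₀ hpos, ← Nat.floor_eq_iff hnn,
    eq_comm (a := (i : ℕ))]
  split_ifs <;> simp

theorem sum_mul_Jhat_mul (n : ℕ) (ξ : ℝ) (c d : Fin (2 ^ n) → ℝ) :
    ∑ k, (∑ j, c j * Jhat n ξ k j) * d k =
      ∫ x in (0 : ℝ)..1, (∫ t in ξ..x, ∑ k, d k * walsh k t) * ∑ j, c j * walsh j x := by
  have hinner : ∀ x, ∫ t in ξ..x, ∑ k, d k * walsh k t = ∑ k, d k * ∫ t in ξ..x, walsh k t := by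
    intro x
    rw [intervalIntegral.integral_finsetSum fun (k : Fin (2 ^ n)) _ =>
      (intervalIntegrable_walsh k ξ x).const_mul (d k)]
    simp only [intervalIntegral.integral_const_mul]
  have hint : ∀ k j : ℕ, IntervalIntegrable
      (fun x => (∫ t in ξ..x, walsh k t) * walsh j x) volume 0 1 := fun k j =>
    (intervalIntegrable_walsh j 0 1).continuousOn_mul
      (intervalIntegral.continuous_primitive (intervalIntegrable_walsh k) ξ).continuousOn
  have hexp : ∀ x, (∫ t in ξ..x, ∑ k, d k * walsh k t) * ∑ j, c j * walsh j x =
      ∑ k : Fin (2 ^ n), ∑ j : Fin (2 ^ n),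
        (d k * c j) * ((∫ t in ξ..x, walsh k t) * walsh j x) := by
    intro x
    rw [hinner, Finset.sum_mul_sum]
    refine Finset.sum_congr rfl fun k _ => Finset.sum_congr rfl fun j _ => ?_
    ring
  simp_rw [hexp]
  have hsum : ∀ k : Fin (2 ^ n), IntervalIntegrable (fun x => ∑ j : Fin (2 ^ n),
      (d k * c j) * ((∫ t in ξ..x, walsh k t) * walsh j x)) volume 0 1 := fun k => by
    simpa only [Finset.sum_fn] using IntervalIntegrable.sum Finset.univ
      fun (j : Fin (2 ^ n)) _ => (hint k j).const_mul (d k * c j)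
  rw [intervalIntegral.integral_finsetSum fun k _ => hsum k]
  refine Finset.sum_congr rfl fun k _ => ?_
  rw [intervalIntegral.integral_finsetSum fun (j : Fin (2 ^ n)) _ => (hint k j).const_mul _,
    Finset.sum_mul]
  refine Finset.sum_congr rfl fun j _ => ?_
  rw [intervalIntegral.integral_const_mul, Jhat]
  ring

theorem conjugated_Jhat_apply_eq_integral (n : ℕ) {ξ : ℝ} (hξ : ξ ∈ Set.Ico (0 : ℝ) 1)
    (i j : Fin (2 ^ n)) :
    ((Wmat n)⁻¹ * (Jhat n ξ)ᵀ * Wmat n) i j =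
      2 ^ n * ∫ x in ((i : ℝ) / 2 ^ n)..(((i : ℝ) + 1) / 2 ^ n),
        (max ((j : ℝ) / 2 ^ n) (min x (((j : ℝ) + 1) / 2 ^ n)) -
          max ((j : ℝ) / 2 ^ n) (min ξ (((j : ℝ) + 1) / 2 ^ n))) := by
  have hpos : (0 : ℝ) < 2 ^ n := by positivity
  have hle : ∀ m : Fin (2 ^ n), (m : ℝ) / 2 ^ n ≤ ((m : ℝ) + 1) / 2 ^ n := fun m => by
    gcongr
    linarith
  have h0 : 0 ≤ (i : ℝ) / 2 ^ n := by positivity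
  have h1 : ((i : ℝ) + 1) / 2 ^ n ≤ 1 := by
    rw [div_le_one hpos]
    exact_mod_cast i.2
  have hsum : ((Wmat n)⁻¹ * (Jhat n ξ)ᵀ * Wmat n) i j =
      (2 ^ n)⁻¹ * ∑ k, (∑ l, Wmat n i l * Jhat n ξ k l) * Wmat n j k := by
    rw [inv_Wmat, Matrix.smul_mul, Matrix.smul_mul, Matrix.smul_apply, Matrix.mul_apply,
      smul_eq_mul]
    congr 1
    refine Finset.sum_congr rfl fun k _ => ?_
    rw [Matrix.mul_apply, Wmat_comm n k j]
    rfl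
  have hcongr : ∫ x in (0 : ℝ)..1, (∫ t in ξ..x, ∑ k, Wmat n j k * walsh k t) *
        ∑ l, Wmat n i l * walsh l x =
      ∫ x in (0 : ℝ)..1, (Set.Ico ((i : ℝ) / 2 ^ n) (((i : ℝ) + 1) / 2 ^ n)).indicator
        (fun x => 2 ^ n * 2 ^ n * (max ((j : ℝ) / 2 ^ n) (min x (((j : ℝ) + 1) / 2 ^ n)) -
          max ((j : ℝ) / 2 ^ n) (min ξ (((j : ℝ) + 1) / 2 ^ n)))) x := by
    refine intervalIntegral.integral_congr_uIoo fun x hx => ?_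
    rw [Set.uIoo_of_le zero_le_one] at hx
    have hx' : x ∈ Set.Ico (0 : ℝ) 1 := ⟨hx.1.le, hx.2⟩
    have hin : ∫ t in ξ..x, ∑ k, Wmat n j k * walsh k t =
        ∫ t in ξ..x, 2 ^ n *
          (Set.Ico ((j : ℝ) / 2 ^ n) (((j : ℝ) + 1) / 2 ^ n)).indicator (fun _ => (1 : ℝ)) t := by
      refine intervalIntegral.integral_congr_uIoo fun t ht => sum_Wmat_mul_walsh n j ?_
      exact ⟨(le_min hξ.1 hx'.1).trans ht.1.le, ht.2.trans (max_lt hξ.2 hx'.2)⟩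
    rw [hin, intervalIntegral.integral_const_mul, integral_indicator_Ico_one (hle j),
      sum_Wmat_mul_walsh n i hx', Set.indicator_apply, Set.indicator_apply]
    split_ifs <;> ring
  have hset : (Set.Ioc 0 1 ∩ Set.Ico ((i : ℝ) / 2 ^ n) (((i : ℝ) + 1) / 2 ^ n) : Set ℝ) =ᵐ[volume]
      (Set.Ioc ((i : ℝ) / 2 ^ n) (((i : ℝ) + 1) / 2 ^ n) : Set ℝ) := by
    refine (ae_eq_set_inter ae_eq_rfl Ico_ae_eq_Ioc).trans ?_
    rw [Set.inter_eq_right.2 (Set.Ioc_subset_Ioc h0 h1)]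
    exact ae_eq_rfl
  rw [hsum, sum_mul_Jhat_mul, hcongr, intervalIntegral.integral_of_le zero_le_one,
    setIntegral_indicator measurableSet_Ico, setIntegral_congr_set hset,
    ← intervalIntegral.integral_of_le (hle i), intervalIntegral.integral_const_mul]
  field_simp

theorem integral_clamp_dyadic (n i j : ℕ) :
    (2 : ℝ) ^ n * ∫ x in ((i : ℝ) / 2 ^ n)..(((i : ℝ) + 1) / 2 ^ n),
        max ((j : ℝ) / 2 ^ n) (min x (((j : ℝ) + 1) / 2 ^ n)) =
      if i < j then (j : ℝ) / 2 ^ n else if i = j then (2 * (j : ℝ) + 1) / 2 ^ (n + 1)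
        else ((j : ℝ) + 1) / 2 ^ n := by
  have hpos : (0 : ℝ) < 2 ^ n := by positivity
  have hle : (i : ℝ) / 2 ^ n ≤ ((i : ℝ) + 1) / 2 ^ n := by
    gcongr
    linarith
  have hj : (j : ℝ) / 2 ^ n ≤ ((j : ℝ) + 1) / 2 ^ n := by
    gcongr
    linarith
  rcases lt_trichotomy i j with h | h | h
  · have hij : ((i : ℝ) + 1) / 2 ^ n ≤ (j : ℝ) / 2 ^ n := by
      gcongr
      exact_mod_cast h
    rw [intervalIntegral.integral_congr (g := fun _ => (j : ℝ) / 2 ^ n) fun x hx => ?_]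
    · rw [if_pos h, intervalIntegral.integral_const, smul_eq_mul]
      field_simp
      ring
    · rw [Set.uIcc_of_le hle] at hx
      exact max_eq_left ((min_le_left _ _).trans (hx.2.trans hij))
  · subst h
    rw [intervalIntegral.integral_congr (g := fun x => x) fun x hx => ?_]
    · rw [if_neg (lt_irrefl _), if_pos rfl, integral_id]
      field_simp
      ring
    · rw [Set.uIcc_of_le hle] at hx
      simp only [min_eq_left hx.2, max_eq_right hx.1]
  · have hij : ((j : ℝ) + 1) / 2 ^ n ≤ (i : ℝ) / 2 ^ n := by
      gcongr
      exact_mod_cast h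
    rw [intervalIntegral.integral_congr (g := fun _ => ((j : ℝ) + 1) / 2 ^ n) fun x hx => ?_]
    · rw [if_neg h.le.not_gt, if_neg h.ne', intervalIntegral.integral_const, smul_eq_mul]
      field_simp
      ring
    · rw [Set.uIcc_of_le hle] at hx
      simp only [min_eq_right (hij.trans hx.1), max_eq_right hj]

theorem clamp_dyadic {n k : ℕ} (j : ℕ) {ξ : ℝ} (hξ1 : (k : ℝ) / 2 ^ n ≤ ξ)
    (hξ2 : ξ ≤ ((k : ℝ) + 1) / 2 ^ n) :
    max ((j : ℝ) / 2 ^ n) (min ξ (((j : ℝ) + 1) / 2 ^ n)) =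
      if k < j then (j : ℝ) / 2 ^ n else if k = j then ξ else ((j : ℝ) + 1) / 2 ^ n := by
  rcases lt_trichotomy k j with h | h | h
  · have hkj : ((k : ℝ) + 1) / 2 ^ n ≤ (j : ℝ) / 2 ^ n := by
      gcongr
      exact_mod_cast h
    rw [if_pos h, max_eq_left ((min_le_left _ _).trans (hξ2.trans hkj))]
  · subst h
    simp [min_eq_left hξ2, max_eq_right hξ1]
  · have hkj : ((j : ℝ) + 1) / 2 ^ n ≤ (k : ℝ) / 2 ^ n := by
      gcongr
      exact_mod_cast h
    have hj : (j : ℝ) / 2 ^ n ≤ ((j : ℝ) + 1) / 2 ^ n := by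
      gcongr
      linarith
    rw [if_neg h.le.not_gt, if_neg h.ne', min_eq_right (hkj.trans hξ1), max_eq_right hj]

/-- The entries of the matrix `W⁻¹ (Ĵ^ξ)ᵀ W`, where `k*` is the index of the dyadic
interval `I_n(k*) = [(k*−1)/2^n, k*/2^n)` containing `ξ`. -/
theorem entries_of_conjugated_Jhat (n : ℕ) (hn : 1 ≤ n) (ξ : ℝ)
    (hξ : ξ ∈ Set.Ico (0:ℝ) 1)
    (kstar : ℕ) (hk1 : 1 ≤ kstar) (hk2 : kstar ≤ 2 ^ n)
    (hξ1 : ((kstar : ℝ) - 1) / 2 ^ n ≤ ξ) (hξ2 : ξ < (kstar : ℝ) / 2 ^ n) :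
    ∀ i j : Fin (2 ^ n),
      ((Wmat n)⁻¹ * (Jhat n ξ)ᵀ * Wmat n) i j =
        if kstar ≤ i.1 then
          (if i.1 = j.1 then 1 / 2 ^ (n + 1)
           else if kstar ≤ j.1 ∧ j.1 < i.1 then 1 / 2 ^ n
           else if j.1 = kstar - 1 then (kstar : ℝ) / 2 ^ n - ξ
           else 0)
        else if kstar = i.1 + 1 then
          (if j.1 = kstar - 1 then (2 * (kstar : ℝ) - 1) / 2 ^ (n + 1) - ξ else 0)
        else
          (if i.1 = j.1 then -(1 / 2 ^ (n + 1))
           else if i.1 + 1 ≤ j.1 ∧ j.1 ≤ kstar - 2 then -(1 / 2 ^ n)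
           else if j.1 = kstar - 1 then ((kstar : ℝ) - 1) / 2 ^ n - ξ
           else 0) := by
  intro i j
  obtain ⟨k, rfl⟩ : ∃ k, kstar = k + 1 := ⟨kstar - 1, by omega⟩
  push_cast at hξ1 hξ2
  rw [add_sub_cancel_right] at hξ1
  have hcont : Continuous fun x : ℝ => max ((j : ℝ) / 2 ^ n) (min x (((j : ℝ) + 1) / 2 ^ n)) := by
    fun_prop
  have hpos : (0 : ℝ) < 2 ^ n := by positivity
  rw [conjugated_Jhat_apply_eq_integral n hξ, intervalIntegral.integral_sub
    (hcont.intervalIntegrable _ _) intervalIntegrable_const, mul_sub, integral_clamp_dyadic,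
    intervalIntegral.integral_const, smul_eq_mul, ← sub_div, add_sub_cancel_left, ← mul_assoc,
    mul_one_div_cancel hpos.ne', one_mul, clamp_dyadic _ hξ1 hξ2.le]
  generalize (i : ℕ) = a
  generalize (j : ℕ) = b
  push_cast
  rw [pow_succ]
  split_ifs <;> first
    | omega
    | (subst_vars; field_simp; ring)
    | (obtain rfl : b = k := by omega
       ring)
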